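/- Birkhoff's transitivity criterion: Let φ : ℝ × M → M be a continuous flow on a metric space M and let T ⊆ M be a nonempty compact invariant set. Suppose that for all open sets U, V ⊆ M with U ∩ T ≠ ∅ and V ∩ T ≠ ∅ there exists s > 0 such that φ_s(U ∩ T) ∩ V ≠ ∅. Then T is transitive: there exists p ∈ T whose ω-limit set ω(p) equals T. -/

import Mathlib

open Filter Metric Topology Set

section

variable {M : Type*} [MetricSpace M]

/-- a continuous flow on `M`. -/
def IsFlow (φ : ℝ → M → M) : Prop :=
  Continuous (fun q : ℝ × M => φ q.1 q.2) ∧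
  (∀ x, φ 0 x = x) ∧
  (∀ s t x, φ (s + t) x = φ s (φ t x))

def FlowInv (φ : ℝ → M → M) (T : Set M) : Prop := ∀ t, φ t '' T = T

/-- ω-limit set: limits of sequences `φ (τ n) p` with `τ n → +∞`. -/
def omegaLim (φ : ℝ → M → M) (p : M) : Set M :=
  {x | ∃ τ : ℕ → ℝ, Tendsto τ atTop atTop ∧ Tendsto (fun n => φ (τ n) p) atTop (𝓝 x)}

theorem FlowInv.apply_mem {X : Type*} {φ : ℝ → X → X} {T : Set X} (hinv : FlowInv φ T) (t : ℝ)
    {x : X} (hx : x ∈ T) : φ t x ∈ T :=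
  hinv t ▸ mem_image_of_mem (φ t) hx

theorem omegaLim_subset_of_isClosed {φ : ℝ → M → M} {T : Set M} (hT : IsClosed T)
    (hinv : FlowInv φ T) {p : M} (hp : p ∈ T) : omegaLim φ p ⊆ T := by
  rintro x ⟨τ, -, hx⟩
  exact hT.mem_of_tendsto hx (Eventually.of_forall fun n => hinv.apply_mem (τ n) hp)

/-- Positive hitting times between relatively open sets can be taken arbitrarily large. -/
theorem exists_hitting_time_gt {φ : ℝ → M → M} (hφ : IsFlow φ) {T : Set M} (hinv : FlowInv φ T)
    (h : ∀ U V : Set M, IsOpen U → IsOpen V → (U ∩ T).Nonempty → (V ∩ T).Nonempty →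
      ∃ s > 0, (φ s '' (U ∩ T) ∩ V).Nonempty)
    {U V : Set M} (hU : IsOpen U) (hV : IsOpen V) (hUT : (U ∩ T).Nonempty)
    (hVT : (V ∩ T).Nonempty) (r : ℝ) : ∃ s > r, ∃ x ∈ U ∩ T, φ s x ∈ V := by
  obtain ⟨y, hyV, hyT⟩ := hVT
  have hy : φ r (φ (-r) y) = y := by rw [← hφ.2.2, add_neg_cancel, hφ.2.1]
  obtain ⟨s, hs, _, ⟨x, hx, rfl⟩, hxV⟩ :=
    h U (φ r ⁻¹' V) hU (hV.preimage (hφ.1.comp (Continuous.prodMk_right r))) hUT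
      ⟨φ (-r) y, by rwa [mem_preimage, hy], hinv.apply_mem _ hyT⟩
  exact ⟨r + s, by linarith, x, hx, by rwa [hφ.2.2]⟩

/-- Birkhoff's transitivity criterion. -/
theorem stmt0 (φ : ℝ → M → M) (hφ : IsFlow φ) (T : Set M)
    (hne : T.Nonempty) (hcomp : IsCompact T) (hinv : FlowInv φ T)
    (h : ∀ U V : Set M, IsOpen U → IsOpen V →
      (U ∩ T).Nonempty → (V ∩ T).Nonempty →
      ∃ s > 0, (φ s '' (U ∩ T) ∩ V).Nonempty) :
    ∃ p ∈ T, omegaLim φ p = T := by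
  have : CompactSpace T := isCompact_iff_compactSpace.mp hcomp
  have : Nonempty T := hne.to_subtype
  let d : ℕ → T := TopologicalSpace.denseSeq T
  let G : ℕ × ℕ → Set T := fun k =>
    {p | ∃ s > (k.2 : ℝ), φ s p ∈ ball (d k.1 : M) (1 / ((k.2 : ℝ) + 1))}
  have hG_open : ∀ k, IsOpen (G k) := by
    intro k
    have hG : G k = ⋃ s > (k.2 : ℝ),
        (fun p : T => φ s p) ⁻¹' ball (d k.1 : M) (1 / ((k.2 : ℝ) + 1)) := by
      ext p
      simp [G]
    rw [hG]
    exact isOpen_biUnion fun s _ => isOpen_ball.preimage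
      ((hφ.1.comp (Continuous.prodMk_right s)).comp continuous_subtype_val)
  have hG_dense : ∀ k, Dense (G k) := by
    intro k
    rw [dense_iff_inter_open]
    rintro W hW ⟨w, hw⟩
    obtain ⟨U, hU, rfl⟩ := isOpen_induced_iff.mp hW
    obtain ⟨s, hs, x, hx, hxV⟩ := exists_hitting_time_gt hφ hinv h hU
      (isOpen_ball (x := (d k.1 : M)) (ε := 1 / ((k.2 : ℝ) + 1))) ⟨w, hw, w.2⟩
      ⟨d k.1, mem_ball_self Nat.one_div_pos_of_nat, (d k.1).2⟩ k.2
    exact ⟨⟨x, hx.2⟩, hx.1, s, hs, hxV⟩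
  obtain ⟨p, hp⟩ := (dense_iInter_of_isOpen hG_open hG_dense).nonempty
  rw [mem_iInter] at hp
  refine ⟨p, p.2, (omegaLim_subset_of_isClosed hcomp.isClosed hinv p.2).antisymm fun x hx => ?_⟩
  have hit : ∀ n : ℕ, ∃ s > (n : ℝ), dist (φ s p) x < 2 * (1 / ((n : ℝ) + 1)) := by
    intro n
    obtain ⟨k, hk⟩ := (TopologicalSpace.denseRange_denseSeq T).exists_dist_lt ⟨x, hx⟩
      (Nat.one_div_pos_of_nat (α := ℝ) (n := n))
    obtain ⟨s, hs, hsk⟩ := hp (k, n)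
    refine ⟨s, hs, ?_⟩
    have hk' : dist x (d k : M) < 1 / ((n : ℝ) + 1) := hk
    have hsk' : dist (φ s p) (d k : M) < 1 / ((n : ℝ) + 1) := hsk
    linarith [dist_triangle_right (φ s p) x (d k : M)]
  choose τ hτ hτx using hit
  refine ⟨τ, tendsto_atTop_mono (fun n => (hτ n).le) tendsto_natCast_atTop_atTop, ?_⟩
  rw [tendsto_iff_dist_tendsto_zero]
  refine squeeze_zero (fun _ => dist_nonneg) (fun n => (hτx n).le) ?_
  simpa using (tendsto_one_div_add_atTop_nhds_zero_nat (𝕜 := ℝ)).const_mul 2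

end
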